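/- In ℂ[x,y], let s = √854 (the positive real square root of 854), and define f2 = (163/171 - (1/171)s)y^2 + (-221/152 - (1/342)s)x - 683/1368 + (1/114)s + (31/152 + (1/342)s)x^2 + x - 31/152 - (1/342)s, g2 = y^2 + (-(7/8)x - 9/8)y + (1/8)x^2 + (5/8)x + 1/4, and h2 = (-2179/4332 + (4/1083)s)y^2 + (1350/361 - (49/1083)s)x - 2036/1083 + (10/361)s + (-(53/1083)s - 131/1444)x^2 + ((29/361)s - 1655/722)x - (34/1083)s + 1997/1444. Let g = f2^3 + g2^2 * h2. Then g is irreducible in ℂ[x,y], and there do not exist polynomials p, q ∈ ℂ[x,y] with total degree of p at most 2 and total degree of q at most 3 such that g = p^3 + q^2. -/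

import Mathlib

open MvPolynomial

noncomputable section

def x : MvPolynomial (Fin 2) ℂ := X 0
def y : MvPolynomial (Fin 2) ℂ := X 1
def c (q : ℚ) : MvPolynomial (Fin 2) ℂ := C (q : ℂ)

/-- `s = √854`, as a constant polynomial. -/
def s : MvPolynomial (Fin 2) ℂ := C ((Real.sqrt 854 : ℝ) : ℂ)

def f2 : MvPolynomial (Fin 2) ℂ :=
  (c (163/171) - c (1/171) * s) * y ^ 2 + (- c (221/152) - c (1/342) * s) * x
    - c (683/1368) + c (1/114) * s + (c (31/152) + c (1/342) * s) * x ^ 2 + x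
    - c (31/152) - c (1/342) * s

def g2 : MvPolynomial (Fin 2) ℂ :=
  y ^ 2 + (- c (7/8) * x - c (9/8)) * y + c (1/8) * x ^ 2 + c (5/8) * x + c (1/4)

def h2 : MvPolynomial (Fin 2) ℂ :=
  (- c (2179/4332) + c (4/1083) * s) * y ^ 2 + (c (1350/361) - c (49/1083) * s) * x
    - c (2036/1083) + c (10/361) * s + (- c (53/1083) * s - c (131/1444)) * x ^ 2
    + (c (29/361) * s - c (1655/722)) * x - c (34/1083) * s + c (1997/1444)

/-- The sextic of semi-torus type with configuration `[E_6 + 4A_2]`. -/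
def g : MvPolynomial (Fin 2) ℂ := f2 ^ 3 + g2 ^ 2 * h2

open scoped Polynomial

theorem aux_E6_alg (px qx pu qu pxx qxx pxu qxu puu quu pxxx qxxx r b : ℂ)
    (e02 : px = 0 ∨ qx = 0) (e20 : pu = 0 ∨ qu = 0)
    (e11 : px * qu + pu * qx = 0)
    (e03 : px * qxx + pxx * qx = 0)
    (e12 : px * qxu + pxx * qu + (pu * qxx + pxu * qx) = 0)
    (e21 : px * quu + (pu * qxu + pxu * qu + puu * qx) = 0)
    (h1 : r ≠ 0) (e30 : pu * quu + puu * qu = r) (h04 : b ≠ 0)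
    (e04 : px * qxxx + (pxx * qxx + pxxx * qx) = b) : False := by
  have key : ∀ (px pu pxx qxx qxu quu qxxx : ℂ), px * qxx = 0 → px * qxu + pu * qxx = 0 →
      px * quu + pu * qxu = 0 → pu * quu = r → px * qxxx + pxx * qxx = b → False := by
    intro px pu pxx qxx qxu quu qxxx a1 a2 a3 a4 a5
    have n1 : pu ≠ 0 := by rintro rfl; simp at a4; exact h1 a4.symm
    have n2 : quu ≠ 0 := by rintro rfl; simp at a4; exact h1 a4.symm
    rcases mul_eq_zero.1 a1 with rfl | rfl
    · simp [n1] at a2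
      subst a2
      simp at a5
      exact h04 a5.symm
    · simp at a2
      rcases a2 with rfl | rfl
      · simp at a5
        exact h04 a5.symm
      · simp [n2] at a3
        subst a3
        simp at a5
        exact h04 a5.symm
  have hl : (px = 0 ∧ pu = 0) ∨ (qx = 0 ∧ qu = 0) := by
    rcases e02 with rfl | rfl <;> rcases e20 with rfl | rfl <;> simp at e11 ⊢ <;> tauto
  rcases hl with ⟨rfl, rfl⟩ | ⟨rfl, rfl⟩
  · exact key qx qu qxx pxx pxu puu pxxx (by linear_combination e03) (by linear_combination e12)
      (by linear_combination e21) (by linear_combination e30) (by linear_combination e04)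
  · exact key px pu pxx qxx qxu quu qxxx (by linear_combination e03) (by linear_combination e12)
      (by linear_combination e21) (by linear_combination e30) (by linear_combination e04)

theorem aux_E6 (P Q : ℂ[X][X]) (B0 B1 B2 : ℂ[X]) (R : ℂ[X][X])
    (h : P * Q = Polynomial.C B0 + Polynomial.C B1 * Polynomial.X
      + Polynomial.C B2 * Polynomial.X^2 + R * Polynomial.X^3)
    (h02 : B0.coeff 2 = 0) (h03 : B0.coeff 3 = 0) (h04 : B0.coeff 4 ≠ 0)
    (h11 : B1.coeff 1 = 0) (h12 : B1.coeff 2 = 0) (h20 : B2.coeff 0 = 0) (h21 : B2.coeff 1 = 0)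
    (h1 : (R.coeff 0).coeff 0 ≠ 0)
    (hP : (P.coeff 0).coeff 0 = 0) (hQ : (Q.coeff 0).coeff 0 = 0) : False := by
  have e (i j : ℕ) := congrArg (fun T : ℂ[X][X] => (T.coeff i).coeff j) h
  have e02 := e 0 2
  have e04 := e 0 4
  have e03 := e 0 3
  have e11 := e 1 1
  have e12 := e 1 2
  have e20 := e 2 0
  have e21 := e 2 1
  have e30 := e 3 0
  clear e h
  simp [Polynomial.coeff_mul, Finset.Nat.antidiagonal_succ, Polynomial.coeff_X, Polynomial.coeff_C,
    Polynomial.coeff_X_pow, hP, hQ, h02, h03, h11, h12, h20, h21] at e02 e04 e03 e11 e12 e20 e21 e30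
  exact aux_E6_alg _ _ _ _ _ _ _ _ _ _ _ _ _ _ e02 e20 e11 e03 e12 e21 h1 e30 h04 e04

/-- The sextic in normalised coordinates. -/
def GG (a b c : ℂ) (h : MvPolynomial (Fin 2) ℂ) : MvPolynomial (Fin 2) ℂ :=
  (X 0 + X 1 + C a * X 0 ^ 2 + C b * (X 0 * X 1) + C c * X 1 ^ 2) ^ 3 + X 0 ^ 2 * X 1 ^ 2 * h

theorem eval_eval_aeval (u v : ℂ[X][X]) (h : MvPolynomial (Fin 2) ℂ) :
    ((aeval ![u, v] h).coeff 0).coeff 0 = eval ![(u.coeff 0).coeff 0, (v.coeff 0).coeff 0] h := by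
  induction h using MvPolynomial.induction_on with
  | C a => simp [Polynomial.algebraMap_apply]
  | add p q hp hq => simp [hp, hq]
  | mul_X p i hp =>
    simp only [map_mul, aeval_X, Polynomial.mul_coeff_zero, hp, eval_X]
    fin_cases i <;> simp

theorem polypoly_split (H : ℂ[X][X]) : ∃ (H0 H1 H2 : ℂ[X]) (H3 : ℂ[X][X]),
    H = Polynomial.C H0 + Polynomial.C H1 * Polynomial.X
      + Polynomial.C H2 * Polynomial.X^2 + H3 * Polynomial.X^3 ∧ H0 = H.coeff 0 := by
  refine ⟨H.coeff 0, H.divX.coeff 0, H.divX.divX.coeff 0, H.divX.divX.divX, ?_, rfl⟩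
  have h1 := H.divX_mul_X_add
  have h2 := H.divX.divX_mul_X_add
  have h3 := H.divX.divX.divX_mul_X_add
  linear_combination -h1 - Polynomial.X * h2 - Polynomial.X^2 * h3

theorem GG_E6 (a b c : ℂ) (h P Q : MvPolynomial (Fin 2) ℂ) (h0 : eval ![0, 0] h ≠ 0)
    (hPQ : GG a b c h = P * Q) (hP : eval ![0, 0] P = 0) (hQ : eval ![0, 0] Q = 0) : False := by
  let φ := aeval (R := ℂ) ![Polynomial.C Polynomial.X,
    (Polynomial.X - Polynomial.C Polynomial.X : ℂ[X][X])]
  have e := congrArg φ hPQ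
  obtain ⟨H0, H1, H2, H3, hH, hH0⟩ := polypoly_split (φ h)
  have hc0 : H0.coeff 0 ≠ 0 := by
    rw [hH0]; simp only [φ, eval_eval_aeval]; simpa using h0
  rw [map_mul] at e
  simp only [GG, map_add, map_mul, map_pow, hH] at e
  have hx : φ (X 0) = Polynomial.C Polynomial.X := by simp [φ]
  have hy : φ (X 1) = Polynomial.X - Polynomial.C Polynomial.X := by simp [φ]
  have hC : ∀ z, φ (C z) = Polynomial.C (Polynomial.C z) := by
    intro z; simp [φ, Polynomial.algebraMap_apply]
  rw [hx, hy, hC, hC, hC] at e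
  obtain ⟨q1, hq1⟩ : ∃ z, z = a - b + c := ⟨_, rfl⟩
  obtain ⟨q2, hq2⟩ : ∃ z, z = b - 2 * c := ⟨_, rfl⟩
  have ha : a = q1 + q2 + c := by rw [hq1, hq2]; ring
  have hb : b = q2 + 2 * c := by rw [hq2]; ring
  subst ha hb
  refine aux_E6 (φ P) (φ Q)
    (Polynomial.X ^ 4 * (H0 + Polynomial.C q1 ^ 3 * Polynomial.X ^ 2))
    (Polynomial.X ^ 3 * (3 * Polynomial.C q1 ^ 2 * Polynomial.X * (1 + Polynomial.C q2 * Polynomial.X)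
      - 2 * H0 + Polynomial.X * H1))
    (Polynomial.X ^ 2 * (3 * Polynomial.C q1 * (1 + Polynomial.C q2 * Polynomial.X) ^ 2
      + 3 * Polynomial.C q1 ^ 2 * Polynomial.C c * Polynomial.X ^ 2 + H0 - 2 * Polynomial.X * H1
      + Polynomial.X ^ 2 * H2))
    (Polynomial.C (1 + Polynomial.C q2 * Polynomial.X) ^ 3
      + Polynomial.C (6 * Polynomial.C c * Polynomial.C q1 * Polynomial.X ^ 2
        * (1 + Polynomial.C q2 * Polynomial.X))
      + Polynomial.X * (Polynomial.C (3 * Polynomial.C c * (1 + Polynomial.C q2 * Polynomial.X) ^ 2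
        + 3 * Polynomial.C c ^ 2 * Polynomial.C q1 * Polynomial.X ^ 2))
      + Polynomial.X ^ 2 * Polynomial.C (3 * Polynomial.C c ^ 2 * (1 + Polynomial.C q2 * Polynomial.X))
      + Polynomial.X ^ 3 * Polynomial.C (Polynomial.C c ^ 3)
      + Polynomial.C (Polynomial.X ^ 2) * (Polynomial.C H1 + Polynomial.C H2 * Polynomial.X
          + H3 * Polynomial.X ^ 2
          - 2 * Polynomial.C Polynomial.X * (Polynomial.C H2 + H3 * Polynomial.X)
          + Polynomial.C Polynomial.X ^ 2 * H3))
    ?_ ?_ ?_ ?_ ?_ ?_ ?_ ?_ ?_ ?_ ?_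
  · rw [← e]
    simp only [map_add, map_mul, map_sub, map_pow, map_one, map_ofNat]
    ring
  · simp [Polynomial.coeff_X_pow_mul']
  · simp [Polynomial.coeff_X_pow_mul']
  · simpa [Polynomial.coeff_X_pow_mul'] using hc0
  · simp [Polynomial.coeff_X_pow_mul']
  · simp [Polynomial.coeff_X_pow_mul']
  · simp [Polynomial.coeff_X_pow_mul']
  · simp [Polynomial.coeff_X_pow_mul']
  · simp [Polynomial.mul_coeff_zero, Polynomial.coeff_zero_eq_eval_zero]
  · simp only [φ, eval_eval_aeval]; simpa using hP
  · simp only [φ, eval_eval_aeval]; simpa using hQ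

theorem low_form (d : ℕ) (P : MvPolynomial (Fin 2) ℂ) (hP : P.totalDegree ≤ d) (hd : d ≤ 2) :
    ∃ p00 p10 p01 p20 p11 p02 : ℂ, P = C p00 + C p10 * X 0 + C p01 * X 1 + C p20 * X 0 ^ 2
      + C p11 * (X 0 * X 1) + C p02 * X 1 ^ 2 ∧ (d ≤ 1 → p11 = 0) := by
  rw [P.as_sum]
  apply Finset.sum_induction _ (fun P : MvPolynomial (Fin 2) ℂ =>
    ∃ p00 p10 p01 p20 p11 p02 : ℂ, P = C p00 + C p10 * X 0 + C p01 * X 1 + C p20 * X 0 ^ 2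
      + C p11 * (X 0 * X 1) + C p02 * X 1 ^ 2 ∧ (d ≤ 1 → p11 = 0))
  · rintro _ _ ⟨a1, a2, a3, a4, a5, a6, rfl, ha⟩ ⟨b1, b2, b3, b4, b5, b6, rfl, hb⟩
    refine ⟨a1 + b1, a2 + b2, a3 + b3, a4 + b4, a5 + b5, a6 + b6, ?_, ?_⟩
    · simp only [map_add]; ring
    · intro h; rw [ha h, hb h, add_zero]
  · exact ⟨0, 0, 0, 0, 0, 0, by simp, fun _ => rfl⟩
  · intro m hm
    have h1 : m 0 + m 1 ≤ d := by
      have := (le_totalDegree hm).trans hP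
      rw [Finsupp.sum_fintype _ _ (by simp)] at this
      simpa [Fin.sum_univ_two] using this
    have h2 : monomial m (coeff m P) = C (coeff m P) * (X 0 ^ (m 0) * X 1 ^ (m 1)) := by
      rw [monomial_eq, Finsupp.prod_fintype _ _ (by simp)]
      simp [Fin.prod_univ_two]
    rw [h2]
    generalize coeff m P = z
    generalize m 0 = i at *
    generalize m 1 = j at *
    have hi : i ≤ 2 := by omega
    have hj : j ≤ 2 := by omega
    interval_cases i <;> interval_cases j
    · exact ⟨z, 0, 0, 0, 0, 0, by simp, by simp⟩
    · exact ⟨0, 0, z, 0, 0, 0, by simp, by simp⟩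
    · exact ⟨0, 0, 0, 0, 0, z, by simp, by simp⟩
    · exact ⟨0, z, 0, 0, 0, 0, by simp, by simp⟩
    · exact ⟨0, 0, 0, 0, z, 0, by simp, by omega⟩
    · omega
    · exact ⟨0, 0, 0, z, 0, 0, by simp, by simp⟩
    · omega
    · omega

theorem line_factor (c : ℂ) (hc : c ≠ 0) (S T : ℂ[X])
    (h : S * T = Polynomial.X ^ 3 * (1 + Polynomial.C c * Polynomial.X) ^ 3)
    (hT : T.coeff 0 ≠ 0) :
    T = Polynomial.C (T.coeff 0) * (1 + Polynomial.C c * Polynomial.X) ^ T.natDegree := by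
  have hdeg : (1 + Polynomial.C c * Polynomial.X : ℂ[X]).natDegree = 1 := by
    rw [add_comm, ← Polynomial.C_1, Polynomial.natDegree_linear hc]
  have hprime : Prime (1 + Polynomial.C c * Polynomial.X : ℂ[X]) := by
    apply Irreducible.prime
    apply Polynomial.irreducible_of_degree_eq_one
    rw [add_comm, ← Polynomial.C_1, Polynomial.degree_linear hc]
  have hX : ¬ (Polynomial.X ∣ T) := by rwa [Polynomial.X_dvd_iff]
  have hco : IsCoprime T (Polynomial.X ^ 3) :=
    ((Polynomial.prime_X.coprime_iff_not_dvd).2 hX).symm.pow_right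
  have hdvd : T ∣ (1 + Polynomial.C c * Polynomial.X : ℂ[X]) ^ 3 :=
    hco.dvd_of_dvd_mul_left (Dvd.intro_left S h)
  obtain ⟨i, -, hi⟩ := (dvd_prime_pow hprime 3).1 hdvd
  obtain ⟨u, hu⟩ := hi.symm
  obtain ⟨r, hr, hru⟩ := Polynomial.isUnit_iff.1 u.isUnit
  rw [← hru] at hu
  have hr0 : r ≠ 0 := hr.ne_zero
  have hn : T.natDegree = i := by
    rw [← hu, Polynomial.natDegree_mul_C hr0, Polynomial.natDegree_pow, hdeg, mul_one]
  have h0 : T.coeff 0 = r := by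
    rw [← hu, Polynomial.coeff_zero_eq_eval_zero]; simp
  rw [hn, h0, ← hu, mul_comm]

theorem aux_cusp (P : ℂ[X][X]) (B0 B1 B2 : ℂ[X]) (R Q : ℂ[X][X])
    (h : P * Q = Polynomial.C B0 + Polynomial.C B1 * Polynomial.X
      + Polynomial.C B2 * Polynomial.X^2 + R * Polynomial.X^3)
    (h00 : B0.coeff 0 = 0) (h01 : B0.coeff 1 = 0) (h02 : B0.coeff 2 ≠ 0)
    (h10 : B1.coeff 0 = 0) (h11 : B1.coeff 1 = 0) (h20 : B2.coeff 0 = 0)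
    (h30 : (R.coeff 0).coeff 0 ≠ 0)
    (hQ : (∃ α γ : ℂ, γ ≠ 0 ∧ Q = Polynomial.C (Polynomial.C α * Polynomial.X)
        + Polynomial.C (Polynomial.C γ) * Polynomial.X) ∨
      (∃ e α β γ : ℂ, γ ≠ 0 ∧ Q = Polynomial.C (Polynomial.C e * Polynomial.X
        + Polynomial.C α * Polynomial.X ^ 2)
        + Polynomial.C (Polynomial.C β * Polynomial.X) * Polynomial.X
        + Polynomial.C (Polynomial.C γ) * Polynomial.X ^ 2)) : False := by
  have e (i j : ℕ) := congrArg (fun T : ℂ[X][X] => (T.coeff i).coeff j) h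
  have e01 := e 0 1
  have e02 := e 0 2
  have e10 := e 1 0
  have e11 := e 1 1
  have e20 := e 2 0
  have e30 := e 3 0
  clear e h
  rcases hQ with ⟨α, γ, hγ, rfl⟩ | ⟨e, α, β, γ, hγ, rfl⟩
  · simp [Polynomial.coeff_mul, Finset.Nat.antidiagonal_succ, Polynomial.coeff_X, Polynomial.coeff_C,
      Polynomial.coeff_X_pow, h00, h01, h10, h11, h20, hγ, -map_mul] at e01 e02 e10 e11 e20 e30
    simp [e20, e10, hγ] at e11
    simp [e11, e10] at e02
    exact h02 e02.symm
  · simp [Polynomial.coeff_mul, Finset.Nat.antidiagonal_succ, Polynomial.coeff_X, Polynomial.coeff_C,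
      Polynomial.coeff_X_pow, h00, h01, h10, h11, h20, hγ, -map_mul, -map_add] at e01 e02 e10 e11 e20 e30
    simp [e20] at e11 e02
    rcases e11 with e11 | e11
    · simp [e11, e20] at e30
      exact h30 e30.symm
    · simp [e11] at e02
      exact h02 e02.symm

theorem GG_cusp (a b c : ℂ) (hc : c ≠ 0) (h P Q : MvPolynomial (Fin 2) ℂ)
    (h1 : eval ![0, -1 / c] h ≠ 0) (hPQ : GG a b c h = P * Q)
    (q0 e : ℂ) (hq0 : q0 ≠ 0)
    (hQ : Q = C q0 * (1 + C a * X 0 + C c * X 1) ∨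
      Q = C q0 * ((1 + C a * X 0 + C c * X 1) ^ 2 + C e * (X 0 * X 1))) : False := by
  let φ := aeval (R := ℂ) ![Polynomial.C Polynomial.X,
    (Polynomial.X - Polynomial.C (Polynomial.C (1 / c)) : ℂ[X][X])]
  have e1 := congrArg φ hPQ
  obtain ⟨H0, H1, H2, H3, hH, hH0⟩ := polypoly_split (φ h)
  have hc0 : H0.coeff 0 ≠ 0 := by
    rw [hH0]; simp only [φ, eval_eval_aeval]; simpa [neg_div] using h1
  rw [map_mul] at e1
  simp only [GG, map_add, map_mul, map_pow, hH] at e1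
  obtain ⟨d, hd⟩ : ∃ d, d = 1 / c := ⟨_, rfl⟩
  have hx : φ (X 0) = Polynomial.C Polynomial.X := by simp [φ]
  have hy : φ (X 1) = Polynomial.X - Polynomial.C (Polynomial.C d) := by simp [φ, hd]
  have hC : ∀ z, φ (C z) = Polynomial.C (Polynomial.C z) := by
    intro z; simp [φ, Polynomial.algebraMap_apply]
  have hcd : c * d = 1 := by rw [hd]; field_simp
  have hd0 : d ≠ 0 := by rintro rfl; simp at hcd
  have hcd' : (Polynomial.C (Polynomial.C c) : ℂ[X][X]) * Polynomial.C (Polynomial.C d) = 1 := by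
    rw [← map_mul, ← map_mul, hcd]; simp
  rw [hx, hy, hC, hC, hC] at e1
  have hf : (Polynomial.C Polynomial.X + (Polynomial.X - Polynomial.C (Polynomial.C d)) +
      Polynomial.C (Polynomial.C a) * Polynomial.C Polynomial.X ^ 2 +
      Polynomial.C (Polynomial.C b) * (Polynomial.C Polynomial.X * (Polynomial.X - Polynomial.C (Polynomial.C d))) +
      Polynomial.C (Polynomial.C c) * (Polynomial.X - Polynomial.C (Polynomial.C d)) ^ 2 : ℂ[X][X])
      = Polynomial.C (Polynomial.X * (Polynomial.C (1 - b * d) + Polynomial.C a * Polynomial.X))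
        + Polynomial.C (-1 + Polynomial.C b * Polynomial.X) * Polynomial.X
        + Polynomial.C (Polynomial.C c) * Polynomial.X ^ 2 := by
    simp only [map_add, map_mul, map_sub, map_neg, map_one, map_pow]
    linear_combination (Polynomial.C (Polynomial.C d) - 2 * Polynomial.X) * hcd'
  rw [hf] at e1
  obtain ⟨F, hF⟩ : ∃ F : ℂ[X], F = Polynomial.C (1 - b * d) + Polynomial.C a * Polynomial.X := ⟨_, rfl⟩
  obtain ⟨F1, hF1⟩ : ∃ F : ℂ[X], F = -1 + Polynomial.C b * Polynomial.X := ⟨_, rfl⟩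
  rw [← hF, ← hF1] at e1
  refine aux_cusp (φ P)
    (Polynomial.X ^ 2 * (Polynomial.X * F ^ 3 + Polynomial.C d ^ 2 * H0))
    (Polynomial.X ^ 2 * (3 * F ^ 2 * F1 - 2 * Polynomial.C d * H0 + Polynomial.C d ^ 2 * H1))
    (Polynomial.X * (3 * F * F1 ^ 2 + 3 * Polynomial.X * F ^ 2 * Polynomial.C c
      + Polynomial.X * (H0 - 2 * Polynomial.C d * H1 + Polynomial.C d ^ 2 * H2)))
    (Polynomial.C (F1 ^ 3) + Polynomial.C (Polynomial.X * (6 * F * F1 * Polynomial.C c))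
      + Polynomial.X * (Polynomial.C (3 * F1 ^ 2 * Polynomial.C c
          + 3 * Polynomial.X * F * Polynomial.C c ^ 2)
        + Polynomial.X * Polynomial.C (3 * F1 * Polynomial.C c ^ 2)
        + Polynomial.X ^ 2 * Polynomial.C (Polynomial.C c ^ 3))
      + Polynomial.C (Polynomial.X ^ 2) * (Polynomial.C H1 + Polynomial.C H2 * Polynomial.X
          + H3 * Polynomial.X ^ 2
          - 2 * Polynomial.C (Polynomial.C d) * (Polynomial.C H2 + H3 * Polynomial.X)
          + Polynomial.C (Polynomial.C d) ^ 2 * H3))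
    (φ Q) ?_ ?_ ?_ ?_ ?_ ?_ ?_ ?_ ?_
  · rw [← e1]
    simp only [map_add, map_mul, map_sub, map_pow, map_ofNat]
    ring
  · simp
  · simp [Polynomial.coeff_X_pow_mul']
  · rw [Polynomial.coeff_X_pow_mul']
    simp [Polynomial.mul_coeff_zero, pow_two, hd0, hc0]
  · simp
  · simp [Polynomial.coeff_X_pow_mul']
  · simp
  · simp [Polynomial.coeff_zero_eq_eval_zero, hF1]
  · rcases hQ with rfl | rfl
    · left
      refine ⟨q0 * a, q0 * c, mul_ne_zero hq0 hc, ?_⟩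
      simp only [map_add, map_mul, map_one, hx, hy, hC]
      linear_combination -Polynomial.C (Polynomial.C q0) * hcd'
    · right
      refine ⟨-q0 * e * d, q0 * a ^ 2, q0 * (2 * a * c + e), q0 * c ^ 2,
        mul_ne_zero hq0 (pow_ne_zero _ hc), ?_⟩
      have h3 : (1 + Polynomial.C (Polynomial.C a) * Polynomial.C Polynomial.X +
        Polynomial.C (Polynomial.C c) * (Polynomial.X - Polynomial.C (Polynomial.C d)) : ℂ[X][X])
        = Polynomial.C (Polynomial.C a) * Polynomial.C Polynomial.X
          + Polynomial.C (Polynomial.C c) * Polynomial.X := by linear_combination -hcd'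
      simp only [map_add, map_mul, map_one, map_pow, hx, hy, hC, h3]
      simp only [map_add, map_mul, map_one, map_pow, map_neg, map_ofNat]
      ring

theorem natDegree_line_le (P : MvPolynomial (Fin 2) ℂ) (d : ℕ) (hP : P.totalDegree ≤ d) (u v : ℂ[X])
    (hu : u.natDegree ≤ 1) (hv : v.natDegree ≤ 1) :
    (aeval ![u, v] P).natDegree ≤ d := by
  have := MvPolynomial.aeval_natDegree_le (n := 1) P hP ![u, v]
    (by intro i; fin_cases i <;> simpa)
  simpa using this

theorem coeff_zero_aeval (u v : ℂ[X]) (h : MvPolynomial (Fin 2) ℂ) :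
    (aeval ![u, v] h).coeff 0 = eval ![u.coeff 0, v.coeff 0] h := by
  induction h using MvPolynomial.induction_on with
  | C a => simp
  | add p q hp hq => simp [hp, hq]
  | mul_X p i hp =>
    simp only [map_mul, aeval_X, Polynomial.mul_coeff_zero, hp, eval_X]
    fin_cases i <;> simp

theorem totalDegree_affine_le (u v : MvPolynomial (Fin 2) ℂ) (hu : u.totalDegree ≤ 1)
    (hv : v.totalDegree ≤ 1) (p : MvPolynomial (Fin 2) ℂ) :
    (aeval ![u, v] p).totalDegree ≤ p.totalDegree := by
  rw [aeval_def, eval₂_eq']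
  apply totalDegree_finsetSum_le
  intro m hm
  have h1 : m 0 + m 1 ≤ p.totalDegree := by
    have := le_totalDegree hm
    rw [Finsupp.sum_fintype _ _ (by simp)] at this
    simpa [Fin.sum_univ_two] using this
  refine (totalDegree_mul _ _).trans ?_
  simp only [algebraMap_eq, totalDegree_C, zero_add, Fin.prod_univ_two]
  refine (totalDegree_mul _ _).trans (le_trans (add_le_add (totalDegree_pow _ _) (totalDegree_pow _ _)) ?_)
  simp only [Matrix.cons_val_zero, Matrix.cons_val_one]
  nlinarith

theorem GG_totalDegree (a b c : ℂ) (h : MvPolynomial (Fin 2) ℂ) (hh : h.totalDegree ≤ 2) :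
    (GG a b c h).totalDegree ≤ 6 := by
  have t (i : Fin 2) : (X i : MvPolynomial (Fin 2) ℂ).totalDegree ≤ 1 := by simp
  have t2 (i : Fin 2) : (X i ^ 2 : MvPolynomial (Fin 2) ℂ).totalDegree ≤ 2 := by simp
  have tc (z : ℂ) (p : MvPolynomial (Fin 2) ℂ) (hp : p.totalDegree ≤ 2) :
      (C z * p).totalDegree ≤ 2 := (totalDegree_mul _ _).trans (by simpa using hp)
  have ad (d : ℕ) (p q : MvPolynomial (Fin 2) ℂ) (hp : p.totalDegree ≤ d) (hq : q.totalDegree ≤ d) :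
      (p + q).totalDegree ≤ d := (totalDegree_add _ _).trans (max_le hp hq)
  have t1 (i : Fin 2) : (X i : MvPolynomial (Fin 2) ℂ).totalDegree ≤ 2 := (t i).trans (by norm_num)
  unfold GG
  apply ad
  · refine (totalDegree_pow _ _).trans ?_
    have : (X 0 + X 1 + C a * X 0 ^ 2 + C b * (X 0 * X 1) + C c * X 1 ^ 2 :
      MvPolynomial (Fin 2) ℂ).totalDegree ≤ 2 := by
      refine ad _ _ _ (ad _ _ _ (ad _ _ _ (ad _ _ _ (t1 0) (t1 1)) (tc _ _ (t2 0))) (tc _ _ ?_)) (tc _ _ (t2 1))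
      exact (totalDegree_mul _ _).trans (by simp)
    omega
  · refine (totalDegree_mul _ _).trans ?_
    have := totalDegree_mul (X 0 ^ 2 : MvPolynomial (Fin 2) ℂ) (X 1 ^ 2)
    have := t2 0
    have := t2 1
    omega

theorem GG_aux (a b c : ℂ) (ha : a ≠ 0) (hc : c ≠ 0) (h P Q : MvPolynomial (Fin 2) ℂ)
    (hd : h.totalDegree ≤ 2) (h0 : eval ![0, 0] h ≠ 0)
    (h1 : eval ![0, -1 / c] h ≠ 0) (hPQ : GG a b c h = P * Q)
    (hQ : eval ![0, 0] Q ≠ 0) : IsUnit Q := by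
  have e := congrArg (aeval (R := ℂ) ![Polynomial.X, (-Polynomial.X : ℂ[X])]) hPQ
  have e1 := congrArg (aeval (R := ℂ) ![0, (Polynomial.X : ℂ[X])]) hPQ
  have e2 := congrArg (aeval (R := ℂ) ![(Polynomial.X : ℂ[X]), 0]) hPQ
  rw [map_mul] at e e1 e2
  simp only [GG, map_add, map_mul, map_pow, aeval_X, Matrix.cons_val_zero, Matrix.cons_val_one,
    algHom_C, Polynomial.algebraMap_eq] at e e1 e2
  have hQ0 : Q ≠ 0 := by rintro rfl; simp at hQ
  have hP4 : 4 ≤ P.totalDegree := by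
    have hx : ¬ (Polynomial.X ∣ aeval (R := ℂ) ![Polynomial.X, (-Polynomial.X : ℂ[X])] Q) := by
      rw [Polynomial.X_dvd_iff, coeff_zero_aeval]; simpa using hQ
    have hh : (aeval (R := ℂ) ![Polynomial.X, (-Polynomial.X : ℂ[X])] h
        + Polynomial.X ^ 2 * Polynomial.C (a - b + c) ^ 3).coeff 0 ≠ 0 := by
      rw [Polynomial.coeff_add, coeff_zero_aeval]; simpa using h0
    have e' : aeval (R := ℂ) ![Polynomial.X, (-Polynomial.X : ℂ[X])] P *
        aeval (R := ℂ) ![Polynomial.X, (-Polynomial.X : ℂ[X])] Q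
        = Polynomial.X ^ 4 * (aeval (R := ℂ) ![Polynomial.X, (-Polynomial.X : ℂ[X])] h
        + Polynomial.X ^ 2 * Polynomial.C (a - b + c) ^ 3) := by
      rw [← e]; simp only [map_add, map_sub]; ring
    have hdv := Polynomial.prime_X.pow_dvd_of_dvd_mul_right 4 hx (Dvd.intro _ e'.symm)
    have hne : aeval (R := ℂ) ![Polynomial.X, (-Polynomial.X : ℂ[X])] P ≠ 0 := by
      intro hz
      rw [hz, zero_mul] at e'
      rcases mul_eq_zero.1 e'.symm with h' | h'
      · simp at h'
      · rw [h'] at hh; simp at hh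
    have := Polynomial.natDegree_le_of_dvd hdv hne
    rw [Polynomial.natDegree_X_pow] at this
    exact this.trans (natDegree_line_le P _ le_rfl _ _ (by simp) (by simp))
  have hP0 : P ≠ 0 := by rintro rfl; simp at hP4
  have hsum : P.totalDegree + Q.totalDegree ≤ 6 := by
    rw [← totalDegree_mul_of_isDomain hP0 hQ0, ← hPQ]; exact GG_totalDegree _ _ _ _ hd
  have line (z : ℂ) (hz : z ≠ 0) (S T : ℂ[X]) (hS : S.natDegree ≤ P.totalDegree)
      (hT : T.natDegree ≤ Q.totalDegree) (hT0 : T.coeff 0 ≠ 0)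
      (hST : S * T = Polynomial.X ^ 3 * (1 + Polynomial.C z * Polynomial.X) ^ 3) :
      T = Polynomial.C (T.coeff 0) * (1 + Polynomial.C z * Polynomial.X) ^ Q.totalDegree := by
    have hdeg : (1 + Polynomial.C z * Polynomial.X : ℂ[X]).natDegree = 1 := by
      rw [add_comm, ← Polynomial.C_1, Polynomial.natDegree_linear hz]
    have hne : (1 + Polynomial.C z * Polynomial.X : ℂ[X]) ≠ 0 := by
      intro h; rw [h] at hdeg; simp at hdeg
    have h6 : (S * T).natDegree = 6 := by
      rw [hST, Polynomial.natDegree_mul (by simp) (pow_ne_zero _ hne), Polynomial.natDegree_pow,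
        Polynomial.natDegree_pow, hdeg, Polynomial.natDegree_X]
    have hST0 : S * T ≠ 0 := by intro h; rw [h] at h6; simp at h6
    rw [Polynomial.natDegree_mul (left_ne_zero_of_mul hST0) (right_ne_zero_of_mul hST0)] at h6
    have : T.natDegree = Q.totalDegree := by omega
    rw [← this]
    exact line_factor z hz S T hST hT0
  have l1 := line c hc _ _ (natDegree_line_le P _ le_rfl 0 Polynomial.X (by simp) (by simp))
    (natDegree_line_le Q _ le_rfl 0 Polynomial.X (by simp) (by simp))
    (by rw [coeff_zero_aeval]; simpa using hQ) (by rw [← e1]; ring)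
  have l2 := line a ha _ _ (natDegree_line_le P _ le_rfl Polynomial.X 0 (by simp) (by simp))
    (natDegree_line_le Q _ le_rfl Polynomial.X 0 (by simp) (by simp))
    (by rw [coeff_zero_aeval]; simpa using hQ) (by rw [← e2]; ring)
  rw [coeff_zero_aeval] at l1 l2
  simp only [Polynomial.coeff_zero, Polynomial.coeff_X_zero] at l1 l2
  have hk : Q.totalDegree ≤ 2 := by omega
  obtain ⟨k, hkk⟩ : ∃ k, k = Q.totalDegree := ⟨_, rfl⟩
  rw [← hkk] at l1 l2 hk
  obtain ⟨q00, q10, q01, q20, q11, q02, hQf, hq11⟩ := low_form k Q hkk.ge hk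
  have hev : eval ![0, 0] Q = q00 := by rw [hQf]; simp
  rw [hev] at l1 l2 hQ
  rw [hQf] at l1 l2
  simp only [map_add, map_mul, map_pow, aeval_X, Matrix.cons_val_zero, Matrix.cons_val_one,
    algHom_C, Polynomial.algebraMap_eq] at l1 l2
  have l11 := congrArg (fun T : ℂ[X] => T.coeff 1) l1
  have l12 := congrArg (fun T : ℂ[X] => T.coeff 2) l1
  have l21 := congrArg (fun T : ℂ[X] => T.coeff 1) l2
  have l22 := congrArg (fun T : ℂ[X] => T.coeff 2) l2
  clear l1 l2
  interval_cases k
  · rw [isUnit_iff_eq_C_of_isReduced]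
    have := totalDegree_eq_zero_iff_eq_C.1 hkk.symm
    refine ⟨_, ?_, this⟩
    rw [this] at hev
    simp at hev
    rw [hev]; exact hQ.isUnit
  · exfalso
    simp [Polynomial.coeff_X, Polynomial.coeff_C, Polynomial.coeff_one] at l11 l12 l21 l22
    refine GG_cusp a b c hc h P Q h1 hPQ q00 0 hQ (Or.inl ?_)
    rw [hQf, hq11 le_rfl, l11, l12, l21, l22]
    simp only [map_mul, map_zero]
    ring
  · exfalso
    have ex (z : ℂ) : Polynomial.C q00 * (1 + Polynomial.C z * Polynomial.X) ^ 2 =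
        Polynomial.C q00 + Polynomial.C (2 * q00 * z) * Polynomial.X
          + Polynomial.C (q00 * z ^ 2) * Polynomial.X ^ 2 := by
      simp only [map_mul, map_pow, map_ofNat]; ring
    rw [ex] at l11 l12 l21 l22
    simp [Polynomial.coeff_X, Polynomial.coeff_C, Polynomial.coeff_one, -map_mul, -map_pow] at l11 l12 l21 l22
    refine GG_cusp a b c hc h P Q h1 hPQ q00 (q11 / q00 - 2 * a * c) hQ (Or.inr ?_)
    have : q11 = q00 * (q11 / q00 - 2 * a * c) + 2 * q00 * a * c := by field_simp; ring
    rw [hQf, l11, l12, l21, l22]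
    nth_rewrite 1 [this]
    simp only [map_mul, map_add, map_pow, map_ofNat]
    ring

theorem GG_irreducible (a b c : ℂ) (ha : a ≠ 0) (hc : c ≠ 0) (h : MvPolynomial (Fin 2) ℂ)
    (hd : h.totalDegree ≤ 2) (h0 : eval ![0, 0] h ≠ 0)
    (h1 : eval ![0, -1 / c] h ≠ 0) : Irreducible (GG a b c h) := by
  have hG : eval ![0, 0] (GG a b c h) = 0 := by simp [GG]
  rw [irreducible_iff]
  constructor
  · intro hu
    have := hu.map (eval (![0, 0] : Fin 2 → ℂ))
    rw [hG] at this
    exact not_isUnit_zero this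
  · intro P Q hPQ
    by_cases hQ : eval ![0, 0] Q = 0
    · by_cases hP : eval ![0, 0] P = 0
      · exact (GG_E6 a b c h P Q h0 hPQ hP hQ).elim
      · exact Or.inl (GG_aux a b c ha hc h Q P hd h0 h1 (by rw [hPQ, mul_comm]) hP)
    · exact Or.inr (GG_aux a b c ha hc h P Q hd h0 h1 hPQ hQ)

theorem quad_uni (p : ℂ[X]) (hp : p.natDegree ≤ 2) : ∃ a0 a1 a2 : ℂ,
    p = Polynomial.C a0 + Polynomial.C a1 * Polynomial.X + Polynomial.C a2 * Polynomial.X ^ 2 := by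
  refine ⟨p.coeff 0, p.coeff 1, p.coeff 2, ?_⟩
  conv_lhs => rw [p.as_sum_range_C_mul_X_pow' (Nat.lt_succ_of_le hp)]
  simp [Finset.sum_range_succ]

theorem cubic_uni (p : ℂ[X]) (hp : p.natDegree ≤ 3) : ∃ a0 a1 a2 a3 : ℂ,
    p = Polynomial.C a0 + Polynomial.C a1 * Polynomial.X + Polynomial.C a2 * Polynomial.X ^ 2
      + Polynomial.C a3 * Polynomial.X ^ 3 := by
  refine ⟨p.coeff 0, p.coeff 1, p.coeff 2, p.coeff 3, ?_⟩
  conv_lhs => rw [p.as_sum_range_C_mul_X_pow' (Nat.lt_succ_of_le hp)]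
  simp [Finset.sum_range_succ]

theorem cube_alg (f0 f1 g0 g1 k0 k1 : ℂ) (hf0 : f0 ≠ 0)
    (e3 : f0 ^ 3 = g0 ^ 3) (e4 : 3 * (f0 ^ 2 * f1) = 3 * (g0 ^ 2 * g1) + k0 ^ 2)
    (e5 : 3 * (f0 * f1 ^ 2) = 3 * (g0 * g1 ^ 2) + 2 * (k0 * k1))
    (e6 : f1 ^ 3 = g1 ^ 3 + k1 ^ 2) : k0 = 0 ∧ k1 = 0 := by
  have hg0 : g0 ≠ 0 := by rintro rfl; simp at e3; exact hf0 e3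
  obtain ⟨ζ, hζ⟩ : ∃ ζ, ζ = g0 / f0 := ⟨_, rfl⟩
  have hg : g0 = ζ * f0 := by rw [hζ]; field_simp
  have hζ3 : ζ ^ 3 = 1 := by
    rw [hζ, div_pow, ← e3]; field_simp
  have hζ0 : ζ ≠ 0 := by rintro rfl; simp at hζ3
  obtain ⟨w, hw⟩ : ∃ w, w = g1 / ζ := ⟨_, rfl⟩
  have hg1 : g1 = ζ * w := by rw [hw]; field_simp
  subst hg hg1
  have E4 : k0 ^ 2 = 3 * f0 ^ 2 * (f1 - w) := by linear_combination -e4 - 3 * f0 ^ 2 * w * hζ3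
  have E5 : 2 * (k0 * k1) = 3 * f0 * (f1 ^ 2 - w ^ 2) := by
    linear_combination -e5 - 3 * f0 * w ^ 2 * hζ3
  have E6 : k1 ^ 2 = f1 ^ 3 - w ^ 3 := by linear_combination -e6 - w ^ 3 * hζ3
  have : f0 ^ 2 * (f1 - w) ^ 4 = 0 := by
    linear_combination (1/3) * ((2 * (k0 * k1) + 3 * f0 * (f1 ^ 2 - w ^ 2)) * E5 - 4 * k1 ^ 2 * E4
      - 12 * f0 ^ 2 * (f1 - w) * E6)
  have hfw : f1 - w = 0 := by
    rcases mul_eq_zero.1 this with h | h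
    · exact absurd h (pow_ne_zero _ hf0)
    · exact pow_eq_zero_iff (by norm_num) |>.1 h
  have hw' : f1 = w := by linear_combination hfw
  subst hw'
  constructor
  · exact pow_eq_zero_iff (two_ne_zero) |>.1 (by linear_combination E4)
  · exact pow_eq_zero_iff (two_ne_zero) |>.1 (by linear_combination E6)

theorem uni_local (f0 f1 : ℂ) (hf0 : f0 ≠ 0) (p q : ℂ[X])
    (hp : p.natDegree ≤ 2) (hq : q.natDegree ≤ 3) (hp0 : p.coeff 0 = 0)
    (h : (Polynomial.X * (Polynomial.C f0 + Polynomial.C f1 * Polynomial.X)) ^ 3 = p ^ 3 + q ^ 2) :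
    q = 0 := by
  obtain ⟨a0, g0, g1, rfl⟩ := quad_uni p hp
  obtain ⟨q0, q1, k0, k1, rfl⟩ := cubic_uni q hq
  have : a0 = 0 := by simpa using hp0
  subst this
  have h' : Polynomial.C (f0 ^ 3) * Polynomial.X ^ 3 + Polynomial.C (3 * (f0 ^ 2 * f1)) * Polynomial.X ^ 4
      + Polynomial.C (3 * (f0 * f1 ^ 2)) * Polynomial.X ^ 5 + Polynomial.C (f1 ^ 3) * Polynomial.X ^ 6 =
      Polynomial.C (q0 ^ 2) + Polynomial.C (2 * q0 * q1) * Polynomial.X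
      + Polynomial.C (q1 ^ 2 + 2 * q0 * k0) * Polynomial.X ^ 2
      + Polynomial.C (g0 ^ 3 + (2 * q0 * k1 + 2 * q1 * k0)) * Polynomial.X ^ 3
      + Polynomial.C (3 * (g0 ^ 2 * g1) + (k0 ^ 2 + 2 * q1 * k1)) * Polynomial.X ^ 4
      + Polynomial.C (3 * (g0 * g1 ^ 2) + 2 * (k0 * k1)) * Polynomial.X ^ 5
      + Polynomial.C (g1 ^ 3 + k1 ^ 2) * Polynomial.X ^ 6 := by
    simp only [map_add, map_mul, map_pow, map_ofNat]
    simp only [map_zero] at h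
    linear_combination h
  have e (j : ℕ) := congrArg (fun T : ℂ[X] => T.coeff j) h'
  have e0 := e 0
  have e2 := e 2
  have e3 := e 3
  have e4 := e 4
  have e5 := e 5
  have e6 := e 6
  clear e h h'
  simp only [Polynomial.coeff_add, Polynomial.coeff_C_mul, Polynomial.coeff_X_pow, Polynomial.coeff_C,
    Polynomial.coeff_X] at e0 e2 e3 e4 e5 e6
  norm_num at e0 e2 e3 e4 e5 e6
  have hq0 : q0 = 0 := pow_eq_zero_iff two_ne_zero |>.1 e0.symm
  subst hq0
  have hq1 : q1 = 0 := pow_eq_zero_iff two_ne_zero |>.1 (by simpa using e2.symm)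
  subst hq1
  obtain ⟨rfl, rfl⟩ := cube_alg f0 f1 g0 g1 k0 k1 hf0 (by linear_combination e3)
    (by linear_combination e4) (by linear_combination e5) (by linear_combination e6)
  simp

theorem uni_coprime (c : ℂ) (hc : c ≠ 0) (p q F : ℂ[X])
    (hF : F = Polynomial.X * (1 + Polynomial.C c * Polynomial.X))
    (hp : p.natDegree ≤ 2) (hq : q.natDegree ≤ 3) (hco : IsCoprime F p)
    (h : F ^ 3 = p ^ 3 + q ^ 2) : q = 0 := by
  have hFd : F.natDegree = 2 := by
    rw [hF]; ring_nf
    rw [add_comm, ← mul_comm (Polynomial.C c)]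
    compute_degree!
  have hF0 : F ≠ 0 := by rintro rfl; simp at hFd
  obtain ⟨V, hV⟩ : ∃ V, V = 2 * F * q.derivative - 3 * F.derivative * q := ⟨_, rfl⟩
  obtain ⟨W, hW⟩ : ∃ W, W = 2 * p * q.derivative - 3 * p.derivative * q := ⟨_, rfl⟩
  have hder := congrArg Polynomial.derivative h
  simp only [Polynomial.derivative_add, Polynomial.derivative_pow] at hder
  norm_num at hder
  simp only [map_ofNat] at hder
  have hVW : F ^ 2 * V = p ^ 2 * W := by
    rw [hV, hW]
    linear_combination 2 * q.derivative * h - q * hder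
  have hdvd : F ^ 2 ∣ W := (hco.pow : IsCoprime (F ^ 2) (p ^ 2)).dvd_of_dvd_mul_left ⟨V, hVW.symm⟩
  have hWd : W.natDegree ≤ 3 := by
    obtain ⟨a0, a1, a2, rfl⟩ := quad_uni p hp
    obtain ⟨b0, b1, b2, b3, rfl⟩ := cubic_uni q hq
    have : W = Polynomial.C (2 * a0 * b1 - 3 * a1 * b0)
        + Polynomial.C (4 * a0 * b2 - a1 * b1 - 6 * a2 * b0) * Polynomial.X
        + Polynomial.C (6 * a0 * b3 + a1 * b2 - 4 * a2 * b1) * Polynomial.X ^ 2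
        + Polynomial.C (3 * a1 * b3 - 2 * a2 * b2) * Polynomial.X ^ 3 := by
      rw [hW]
      simp only [Polynomial.derivative_add, Polynomial.derivative_C, Polynomial.derivative_C_mul,
        Polynomial.derivative_X, Polynomial.derivative_X_pow, map_sub, map_add, map_mul, map_ofNat,
        Nat.cast_ofNat]
      norm_num
      ring
    rw [this]
    compute_degree
  have hW0 : W = 0 := by
    apply Polynomial.eq_zero_of_dvd_of_natDegree_lt hdvd
    rw [Polynomial.natDegree_pow, hFd]; omega
  have hV0 : V = 0 := by
    rw [hW0, mul_zero] at hVW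
    exact (mul_eq_zero.1 hVW).resolve_left (pow_ne_zero _ hF0)
  have hz : q * (p * F.derivative - F * p.derivative) = 0 := by
    rw [hW0] at hW
    rw [hV0] at hV
    have h3 : 3 * (q * (p * F.derivative - F * p.derivative)) = 0 := by
      linear_combination p * hV - F * hW
    exact (mul_eq_zero.1 h3).resolve_left (by norm_num)
  rcases mul_eq_zero.1 hz with h0 | h0
  · exact h0
  · exfalso
    have hd : F ∣ F.derivative := hco.dvd_of_dvd_mul_left ⟨p.derivative, by linear_combination h0⟩
    have h1 : F.derivative = 0 := by
      apply Polynomial.eq_zero_of_dvd_of_natDegree_lt hd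
      exact Polynomial.natDegree_derivative_lt (by omega)
    have := Polynomial.derivative_eq_zero.1 h1
    omega

theorem uni_main (c : ℂ) (hc : c ≠ 0) (p q : ℂ[X])
    (hp : p.natDegree ≤ 2) (hq : q.natDegree ≤ 3)
    (h : (Polynomial.X * (1 + Polynomial.C c * Polynomial.X)) ^ 3 = p ^ 3 + q ^ 2) : q = 0 := by
  by_cases hco : IsCoprime (Polynomial.X * (1 + Polynomial.C c * Polynomial.X)) p
  · exact uni_coprime c hc p q _ rfl hp hq hco h
  · rw [Polynomial.isCoprime_iff_aeval_ne_zero_of_isAlgClosed ℂ ℂ] at hco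
    push Not at hco
    obtain ⟨r, hr1, hr2⟩ := hco
    simp at hr1 hr2
    have h2 := congrArg (fun T : ℂ[X] => T.comp (Polynomial.X + Polynomial.C r)) h
    simp only [Polynomial.add_comp, Polynomial.mul_comp, Polynomial.pow_comp, Polynomial.X_comp,
      Polynomial.C_comp, Polynomial.one_comp] at h2
    have hz : r + c * r ^ 2 = 0 := by
      rcases hr1 with hr | hr
      · simp [hr]
      · linear_combination r * hr
    have hz' : (Polynomial.C r + Polynomial.C c * Polynomial.C r ^ 2 : ℂ[X]) = 0 := by
      rw [← map_pow, ← map_mul, ← map_add, hz, map_zero]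
    have h3 : (Polynomial.X + Polynomial.C r) * (1 + Polynomial.C c * (Polynomial.X + Polynomial.C r))
        = Polynomial.X * (Polynomial.C (1 + 2 * c * r) + Polynomial.C c * Polynomial.X) := by
      simp only [map_add, map_mul, map_one, map_ofNat]
      linear_combination hz'
    rw [h3] at h2
    have h4 := uni_local (1 + 2 * c * r) c ?_ _ _ ?_ ?_ ?_ h2
    · exact (Polynomial.comp_X_add_C_eq_zero_iff).1 h4
    · rcases hr1 with hr | hr
      · simp [hr]
      · intro h'
        have : (1 : ℂ) = 0 := by linear_combination 2 * hr - h'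
        norm_num at this
    · rw [Polynomial.natDegree_comp]; simpa using hp
    · rw [Polynomial.natDegree_comp]; simpa using hq
    · rw [Polynomial.coeff_zero_eq_eval_zero]; simpa using hr2

theorem X0_dvd (q : MvPolynomial (Fin 2) ℂ) :
    X 0 ∣ q - Polynomial.aeval (X 1 : MvPolynomial (Fin 2) ℂ) (aeval ![0, (Polynomial.X : ℂ[X])] q) := by
  induction q using MvPolynomial.induction_on with
  | C a => simp [algebraMap_eq]
  | add p q hp hq =>
    convert dvd_add hp hq using 1
    simp only [map_add]; ring
  | mul_X p i hp =>
    fin_cases i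
    · simp
    · convert hp.mul_right (X 1) using 1
      simp
      ring

theorem X1_dvd (q : MvPolynomial (Fin 2) ℂ) :
    X 1 ∣ q - Polynomial.aeval (X 0 : MvPolynomial (Fin 2) ℂ) (aeval ![(Polynomial.X : ℂ[X]), 0] q) := by
  induction q using MvPolynomial.induction_on with
  | C a => simp [algebraMap_eq]
  | add p q hp hq =>
    convert dvd_add hp hq using 1
    simp only [map_add]; ring
  | mul_X p i hp =>
    fin_cases i
    · convert hp.mul_right (X 0) using 1
      simp
      ring
    · simp

theorem cube_line (c p0 p1 p2 : ℂ)
    (h : (Polynomial.X * (1 + Polynomial.C c * Polynomial.X)) ^ 3 =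
      (Polynomial.C p0 + Polynomial.C p1 * Polynomial.X + Polynomial.C p2 * Polynomial.X ^ 2) ^ 3) :
    p0 = 0 ∧ p1 ^ 3 = 1 ∧ p2 = p1 * c := by
  have h0 : p0 = 0 := by
    have := congrArg (Polynomial.eval 0) h
    simpa using this.symm
  subst h0
  have h' : Polynomial.X ^ 3 * (Polynomial.C 1 + Polynomial.C (3 * c) * Polynomial.X
      + Polynomial.X ^ 2 * (3 * Polynomial.C c ^ 2 + Polynomial.C c ^ 3 * Polynomial.X)) =
      Polynomial.X ^ 3 * (Polynomial.C (p1 ^ 3) + Polynomial.C (3 * p1 ^ 2 * p2) * Polynomial.X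
      + Polynomial.X ^ 2 * (3 * Polynomial.C p1 * Polynomial.C p2 ^ 2
        + Polynomial.C p2 ^ 3 * Polynomial.X)) := by
    simp only [map_mul, map_pow, map_ofNat, map_one]
    simp only [map_zero] at h
    linear_combination h
  have e (j : ℕ) := congrArg (fun T : ℂ[X] => T.coeff j) h'
  have e3 := e 3
  have e4 := e 4
  simp only [Polynomial.coeff_X_pow_mul', Polynomial.coeff_add, Polynomial.coeff_C_mul,
    Polynomial.coeff_C, Polynomial.coeff_X] at e3 e4
  norm_num at e3 e4
  refine ⟨rfl, e3.symm, ?_⟩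
  linear_combination p2 * e3 - p1 / 3 * e4

theorem GG_nontorus (a b c : ℂ) (ha : a ≠ 0) (hc : c ≠ 0) (h p q : MvPolynomial (Fin 2) ℂ)
    (hsq : ∀ m, h ≠ m ^ 2) (hp : p.totalDegree ≤ 2) (hq : q.totalDegree ≤ 3)
    (hG : GG a b c h = p ^ 3 + q ^ 2) : False := by
  have e1 := congrArg (aeval (R := ℂ) ![0, (Polynomial.X : ℂ[X])]) hG
  have e2 := congrArg (aeval (R := ℂ) ![(Polynomial.X : ℂ[X]), 0]) hG
  simp only [GG, map_add, map_mul, map_pow, aeval_X, Matrix.cons_val_zero, Matrix.cons_val_one,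
    algHom_C, Polynomial.algebraMap_eq] at e1 e2
  have e1' : (Polynomial.X * (1 + Polynomial.C c * Polynomial.X)) ^ 3 =
    (aeval (R := ℂ) ![0, (Polynomial.X : ℂ[X])] p) ^ 3
      + (aeval (R := ℂ) ![0, (Polynomial.X : ℂ[X])] q) ^ 2 := by rw [← e1]; ring
  have e2' : (Polynomial.X * (1 + Polynomial.C a * Polynomial.X)) ^ 3 =
    (aeval (R := ℂ) ![(Polynomial.X : ℂ[X]), 0] p) ^ 3
      + (aeval (R := ℂ) ![(Polynomial.X : ℂ[X]), 0] q) ^ 2 := by rw [← e2]; ring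
  have q1 := uni_main c hc _ _ (natDegree_line_le p _ hp 0 Polynomial.X (by simp) (by simp))
    (natDegree_line_le q _ hq 0 Polynomial.X (by simp) (by simp)) e1'
  have q2 := uni_main a ha _ _ (natDegree_line_le p _ hp Polynomial.X 0 (by simp) (by simp))
    (natDegree_line_le q _ hq Polynomial.X 0 (by simp) (by simp)) e2'
  rw [q1] at e1'
  rw [q2] at e2'
  obtain ⟨r, rfl⟩ : X 0 ∣ q := by have := X0_dvd q; rwa [q1, map_zero, sub_zero] at this
  have q2' : aeval (R := ℂ) ![(Polynomial.X : ℂ[X]), 0] r = 0 := by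
    simpa using q2
  obtain ⟨m, rfl⟩ : X 1 ∣ r := by have := X1_dvd r; rwa [q2', map_zero, sub_zero] at this
  obtain ⟨p00, p10, p01, p20, p11, p02, rfl, -⟩ := low_form 2 p hp le_rfl
  obtain ⟨z1, z2, z3⟩ := cube_line c p00 p01 p02 (by
    rw [e1']
    simp only [map_add, map_mul, map_pow, aeval_X, Matrix.cons_val_zero, Matrix.cons_val_one,
      algHom_C, Polynomial.algebraMap_eq]; ring)
  obtain ⟨-, w2, w3⟩ := cube_line a p00 p10 p20 (by
    rw [e2']
    simp only [map_add, map_mul, map_pow, aeval_X, Matrix.cons_val_zero, Matrix.cons_val_one,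
      algHom_C, Polynomial.algebraMap_eq]; ring)
  subst z1 z3 w3
  have e3 := congrArg (aeval (R := ℂ) ![(Polynomial.X : ℂ[X]), -Polynomial.X]) hG
  simp only [GG, map_add, map_mul, map_pow, aeval_X, Matrix.cons_val_zero, Matrix.cons_val_one,
    algHom_C, Polynomial.algebraMap_eq, map_zero] at e3
  have hpp : p10 = p01 := by
    generalize aeval (R := ℂ) ![(Polynomial.X : ℂ[X]), -Polynomial.X] h = hh at e3
    generalize aeval (R := ℂ) ![(Polynomial.X : ℂ[X]), -Polynomial.X] m = mm at e3
    have e4 : Polynomial.X ^ 3 * (Polynomial.X * ((Polynomial.C a - Polynomial.C b + Polynomial.C c) ^ 3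
        * Polynomial.X ^ 2 + hh)) = Polynomial.X ^ 3 * ((Polynomial.C p10 - Polynomial.C p01
          + Polynomial.X * (Polynomial.C p10 * Polynomial.C a - Polynomial.C p11
            + Polynomial.C p01 * Polynomial.C c)) ^ 3 + Polynomial.X * mm ^ 2) := by
      linear_combination e3
    have e5 := mul_left_cancel₀ (pow_ne_zero 3 Polynomial.X_ne_zero) e4
    have e6 := congrArg (Polynomial.eval 0) e5
    simp at e6
    exact sub_eq_zero.1 (pow_eq_zero_iff (by norm_num) |>.1 e6.symm)
  subst hpp
  have key : (X 0 * X 1 : MvPolynomial (Fin 2) ℂ) * (X 0 * X 1 * h) =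
      (X 0 * X 1) * (3 * C p10 ^ 2 * C (p11 - p10 * b) * (X 0 + X 1 + C a * X 0 ^ 2 + C b * (X 0 * X 1) + C c * X 1 ^ 2) ^ 2
        + 3 * C p10 * C (p11 - p10 * b) ^ 2 * (X 0 + X 1 + C a * X 0 ^ 2 + C b * (X 0 * X 1) + C c * X 1 ^ 2) * (X 0 * X 1)
        + C (p11 - p10 * b) ^ 3 * (X 0 * X 1) ^ 2 + X 0 * X 1 * m ^ 2) := by
    have hz : (C p10 : MvPolynomial (Fin 2) ℂ) ^ 3 = 1 := by rw [← map_pow, z2, map_one]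
    simp only [GG, map_mul, map_zero] at hG
    simp only [map_sub, map_mul]
    linear_combination hG + (X 0 + X 1 + C a * X 0 ^ 2 + C b * (X 0 * X 1) + C c * X 1 ^ 2) ^ 3 * hz
  have hXY : (X 0 * X 1 : MvPolynomial (Fin 2) ℂ) ≠ 0 := mul_ne_zero (X_ne_zero _) (X_ne_zero _)
  have key2 := mul_left_cancel₀ hXY key
  have hp0 : p10 ≠ 0 := by rintro rfl; simp at z2
  have he : p11 - p10 * b = 0 := by
    generalize p11 - p10 * b = w at key2
    have e6 := congrArg (eval ![1, 0]) key2
    have e7 := congrArg (eval ![2, 0]) key2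
    simp [hp0] at e6 e7
    rcases e6 with e6 | e6
    · exact e6
    · rcases e7 with e7 | e7
      · exact e7
      · exfalso
        have : (2 : ℂ) = 0 := by linear_combination 4 * e6 - e7
        norm_num at this
  rw [he] at key2
  simp only [map_zero] at key2
  apply hsq m
  apply mul_left_cancel₀ hXY
  linear_combination key2

theorem transfer (fx fy A B t1 t2 : ℂ) (hδ : t2 - t1 ≠ 0) (h1 : fx + fy * t1 ≠ 0)
    (h2 : fx + fy * t2 ≠ 0) (h3 : A * t1 ^ 2 + B ≠ 0) (h4 : A * t2 ^ 2 + B ≠ 0)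
    (F G H : MvPolynomial (Fin 2) ℂ)
    (hF : F = C fx * (X 0 - 1) + C fy * (X 1 - 1) + C A * (X 1 - 1) ^ 2 + C B * (X 0 - 1) ^ 2)
    (hG : G = ((X 1 - 1) - C t1 * (X 0 - 1)) * ((X 1 - 1) - C t2 * (X 0 - 1)))
    (hH : H.totalDegree ≤ 2) (hsq : ∀ m, H ≠ m ^ 2)
    (e0 : eval ![1, 1] H ≠ 0)
    (e1 : eval ![1 - (fx + fy * t1) / (A * t1 ^ 2 + B), 1 - t1 * (fx + fy * t1) / (A * t1 ^ 2 + B)] H ≠ 0) :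
    Irreducible (F ^ 3 + G ^ 2 * H) ∧ ¬ ∃ p q : MvPolynomial (Fin 2) ℂ,
        p.totalDegree ≤ 2 ∧ q.totalDegree ≤ 3 ∧ F ^ 3 + G ^ 2 * H = p ^ 3 + q ^ 2 := by
  obtain ⟨P1, hP1⟩ : ∃ P1, P1 = fx + fy * t1 := ⟨_, rfl⟩
  obtain ⟨P2, hP2⟩ : ∃ P2, P2 = fx + fy * t2 := ⟨_, rfl⟩
  obtain ⟨δ, hδ'⟩ : ∃ δ, δ = t2 - t1 := ⟨_, rfl⟩
  rw [← hP1] at h1 e1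
  rw [← hP2] at h2
  rw [← hδ'] at hδ
  obtain ⟨i, hi⟩ : ∃ i, i = P2⁻¹ := ⟨_, rfl⟩
  obtain ⟨k, hk⟩ : ∃ k, k = P1⁻¹ := ⟨_, rfl⟩
  obtain ⟨d, hd⟩ : ∃ d, d = δ⁻¹ := ⟨_, rfl⟩
  have hi1 : i * P2 = 1 := by rw [hi]; field_simp
  have hk1 : k * P1 = 1 := by rw [hk]; field_simp
  have hd1 : d * δ = 1 := by rw [hd]; field_simp
  have hi0 : i ≠ 0 := by rw [hi]; exact inv_ne_zero h2
  have hk0 : k ≠ 0 := by rw [hk]; exact inv_ne_zero h1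
  have ci : (C i * C P2 : MvPolynomial (Fin 2) ℂ) = 1 := by rw [← map_mul, hi1, map_one]
  have ck : (C k * C P1 : MvPolynomial (Fin 2) ℂ) = 1 := by rw [← map_mul, hk1, map_one]
  have cd : (C d * C δ : MvPolynomial (Fin 2) ℂ) = 1 := by rw [← map_mul, hd1, map_one]
  have cP1 : (C P1 : MvPolynomial (Fin 2) ℂ) = C fx + C fy * C t1 := by rw [hP1]; simp
  have cP2 : (C P2 : MvPolynomial (Fin 2) ℂ) = C fx + C fy * C t2 := by rw [hP2]; simp
  have cδ : (C δ : MvPolynomial (Fin 2) ℂ) = C t2 - C t1 := by rw [hδ']; simp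
  let u : MvPolynomial (Fin 2) ℂ := 1 + C i * X 0 + C k * X 1
  let v : MvPolynomial (Fin 2) ℂ := 1 + C t2 * C i * X 0 + C t1 * C k * X 1
  let u' : MvPolynomial (Fin 2) ℂ := C P2 * C d * ((X 1 - 1) - C t1 * (X 0 - 1))
  let v' : MvPolynomial (Fin 2) ℂ := - C P1 * C d * ((X 1 - 1) - C t2 * (X 0 - 1))
  let e : MvPolynomial (Fin 2) ℂ ≃ₐ[ℂ] MvPolynomial (Fin 2) ℂ :=
    AlgEquiv.ofAlgHom (aeval ![u, v]) (aeval ![u', v'])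
      (by
        ext j : 1
        fin_cases j
        · simp [u, v, u', algHom_C, algebraMap_eq]
          linear_combination (C P2 * C i * X 0) * (cd - C d * cδ) + X 0 * ci
        · simp [u, v, v', algHom_C, algebraMap_eq]
          linear_combination (C P1 * C k * X 1) * (cd - C d * cδ) + X 1 * ck)
      (by
        ext j : 1
        fin_cases j
        · simp [u, u', v', algHom_C, algebraMap_eq]
          linear_combination (C d * ((X 1 - 1) - C t1 * (X 0 - 1))) * ci
            - (C d * ((X 1 - 1) - C t2 * (X 0 - 1))) * ck + (X 0 - 1) * (cd - C d * cδ)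
        · simp [v, u', v', algHom_C, algebraMap_eq]
          linear_combination (C t2 * C d * ((X 1 - 1) - C t1 * (X 0 - 1))) * ci
            - (C t1 * C d * ((X 1 - 1) - C t2 * (X 0 - 1))) * ck + (X 1 - 1) * (cd - C d * cδ))
  have hex (p) : e p = aeval ![u, v] p := rfl
  have hu : u.totalDegree ≤ 1 := by
    simp only [u]
    refine (totalDegree_add _ _).trans (max_le ((totalDegree_add _ _).trans (max_le (by simp) ?_)) ?_)
    · exact (totalDegree_mul _ _).trans (by simp)
    · exact (totalDegree_mul _ _).trans (by simp)
  have hv : v.totalDegree ≤ 1 := by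
    simp only [v, ← map_mul]
    refine (totalDegree_add _ _).trans (max_le ((totalDegree_add _ _).trans (max_le (by simp) ?_)) ?_)
    · exact (totalDegree_mul _ _).trans (by rw [totalDegree_C, totalDegree_X])
    · exact (totalDegree_mul _ _).trans (by rw [totalDegree_C, totalDegree_X])
  obtain ⟨w, hw⟩ : ∃ w, w = δ ^ 2 * i * k := ⟨_, rfl⟩
  have hw0 : w ≠ 0 := by
    rw [hw]; exact mul_ne_zero (mul_ne_zero (pow_ne_zero _ hδ) hi0) hk0
  have hGG : e (F ^ 3 + G ^ 2 * H) = GG ((A * t2 ^ 2 + B) * i ^ 2) (2 * (A * t1 * t2 + B) * i * k)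
      ((A * t1 ^ 2 + B) * k ^ 2) (C (w ^ 2) * e H) := by
    have eF : e F = X 0 + X 1 + C ((A * t2 ^ 2 + B) * i ^ 2) * X 0 ^ 2
        + C (2 * (A * t1 * t2 + B) * i * k) * (X 0 * X 1) + C ((A * t1 ^ 2 + B) * k ^ 2) * X 1 ^ 2 := by
      rw [hex, hF]
      simp only [map_add, map_mul, map_sub, map_pow, aeval_X, algHom_C, algebraMap_eq, map_one,
        Matrix.cons_val_zero, Matrix.cons_val_one, map_ofNat, u, v]
      linear_combination X 0 * (ci - C i * cP2) + X 1 * (ck - C k * cP1)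
    have eG : e G = - C w * (X 0 * X 1) := by
      rw [hex, hG, hw]
      simp only [map_add, map_mul, map_sub, map_pow, aeval_X, algHom_C, algebraMap_eq, map_one,
        Matrix.cons_val_zero, Matrix.cons_val_one, map_ofNat, u, v, cδ]
      ring
    rw [map_add, map_pow, map_mul, map_pow, eF, eG, GG, map_pow]
    ring
  have ha : (A * t2 ^ 2 + B) * i ^ 2 ≠ 0 := mul_ne_zero h4 (pow_ne_zero _ hi0)
  have hc : (A * t1 ^ 2 + B) * k ^ 2 ≠ 0 := mul_ne_zero h3 (pow_ne_zero _ hk0)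
  have hev (a b : ℂ) : eval ![a, b] (e H) =
      eval ![1 + i * a + k * b, 1 + t2 * i * a + t1 * k * b] H := by
    rw [hex]
    clear hGG hH hsq e0 e1
    induction H using MvPolynomial.induction_on with
    | C a => simp [algHom_C, algebraMap_eq]
    | add p q hp hq => simp only [map_add, hp, hq]
    | mul_X p j hp =>
      rw [map_mul, map_mul, map_mul, hp]
      congr 1
      fin_cases j <;> simp [u, v]
  constructor
  · rw [← MulEquiv.irreducible_iff (e : MvPolynomial (Fin 2) ℂ ≃* MvPolynomial (Fin 2) ℂ)]
    change Irreducible (e (F ^ 3 + G ^ 2 * H))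
    rw [hGG]
    apply GG_irreducible _ _ _ ha hc
    · refine (totalDegree_mul _ _).trans ?_
      rw [totalDegree_C, zero_add, hex]
      exact (totalDegree_affine_le u v hu hv H).trans hH
    · rw [map_mul, eval_C, hev]
      refine mul_ne_zero (pow_ne_zero _ hw0) ?_
      simpa using e0
    · rw [map_mul, eval_C, hev]
      refine mul_ne_zero (pow_ne_zero _ hw0) ?_
      convert e1 using 4
      · rw [hk]; field_simp; ring
      · rw [hk]; field_simp; ring
  · rintro ⟨p, q, hp, hq, hpq⟩
    have := congrArg e hpq
    rw [hGG, map_add, map_pow e p, map_pow e q] at this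
    refine GG_nontorus _ _ _ ha hc _ (e p) (e q) ?_ ?_ ?_ this
    · intro m hm
      apply hsq (C w⁻¹ * e.symm m)
      apply e.injective
      have hww : (C w⁻¹ * C w : MvPolynomial (Fin 2) ℂ) = 1 := by
        rw [← map_mul, inv_mul_cancel₀ hw0, map_one]
      rw [map_pow, map_mul, e.apply_symm_apply]
      have : e (C w⁻¹) = C w⁻¹ := by rw [hex, algHom_C, algebraMap_eq]
      rw [this, mul_pow, ← hm, map_pow]
      linear_combination -(C w⁻¹ * C w + 1) * (e H) * hww
    · exact (totalDegree_affine_le u v hu hv p).trans hp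
    · exact (totalDegree_affine_le u v hu hv q).trans hq

theorem real_facts (r u : ℝ) (hr : r ^ 2 = 854) (hu : u ^ 2 = 17) (hr0 : 0 ≤ r) (hu0 : 0 ≤ u) :
    0 < (-7/152 + r/342) + 2 * ((163 - r)/171) * ((7 - u)/16) ∧
    0 < (-7/152 + r/342) + 2 * ((163 - r)/171) * ((7 + u)/16) ∧
    0 < (163 - r)/171 * ((7 - u)/16)^2 + (31/152 + r/342) ∧
    0 < (163 - r)/171 * ((7 + u)/16)^2 + (31/152 + r/342) ∧
    0 < u ∧ 25.75 < r ∧ r < 30 ∧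
    (1545 - 60 * r)/4332 * ((163 - r)/171 * ((7 - u)/16)^2 + (31/152 + r/342))^2
      - (((1350/361 - 49/1083*r) + (29/361*r - 1655/722) + 2 * (-(53/1083)*r-131/1444))
          + ((7 - u)/16) * (2 * (-2179/4332+4/1083*r)))
        * ((-7/152 + r/342) + 2 * ((163 - r)/171) * ((7 - u)/16))
        * ((163 - r)/171 * ((7 - u)/16)^2 + (31/152 + r/342))
      + ((-2179/4332+4/1083*r) * ((7 - u)/16)^2 + (-(53/1083)*r-131/1444))
        * ((-7/152 + r/342) + 2 * ((163 - r)/171) * ((7 - u)/16))^2 < 0 := by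
  have r1 : 29.223 < r := by nlinarith
  have r2 : r < 29.224 := by nlinarith
  have u1 : 4.123 < u := by nlinarith
  have u2 : u < 4.124 := by nlinarith
  have w1 : 29.223 * 4.123 < r * u := by nlinarith
  have w2 : r * u < 29.224 * 4.124 := by nlinarith
  refine ⟨by linarith, by linarith, ?_, ?_, by linarith, by linarith, by linarith, ?_⟩
  · have : 0 < 163 - r := by linarith
    positivity
  · have : 0 < 163 - r := by linarith
    positivity
  · have hQ : (163 - r)/171 * ((7 - u)/16)^2 + (31/152 + r/342)
        = 3281/7296 + 31/21888*r - 1141/21888*u + 7/21888*(r*u) := by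
      linear_combination (163 - r)/171/256 * hu
    have hP : (-7/152 + r/342) + 2 * ((163 - r)/171) * ((7 - u)/16)
        = 539/684 - 1/456*r - 163/1368*u + 1/1368*(r*u) := by ring
    have key : (1545 - 60 * r)/4332 * ((163 - r)/171 * ((7 - u)/16)^2 + (31/152 + r/342))^2
      - (((1350/361 - 49/1083*r) + (29/361*r - 1655/722) + 2 * (-(53/1083)*r-131/1444))
          + ((7 - u)/16) * (2 * (-2179/4332+4/1083*r)))
        * ((-7/152 + r/342) + 2 * ((163 - r)/171) * ((7 - u)/16))
        * ((163 - r)/171 * ((7 - u)/16)^2 + (31/152 + r/342))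
      + ((-2179/4332+4/1083*r) * ((7 - u)/16)^2 + (-(53/1083)*r-131/1444))
        * ((-7/152 + r/342) + 2 * ((163 - r)/171) * ((7 - u)/16))^2
      = -48017731055/172949520384 - 329300717/21618690048*r + 1070263457/19216613376*u
        + 72196315/21618690048*(r*u) := by
      have hr3 : r ^ 3 = 854 * r := by linear_combination r * hr
      have hu3 : u ^ 3 = 17 * u := by linear_combination u * hu
      have hu4 : u ^ 4 = 289 := by linear_combination (u ^ 2 + 17) * hu
      ring_nf
      simp only [hr, hr3, hu, hu3, hu4]
      ring
    rw [key]
    linarith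

theorem nonsq (p q v w : ℂ) (hp : p ≠ 0) (hq : q ≠ 0) (m : MvPolynomial (Fin 2) ℂ) :
    C p * X 1 ^ 2 + C q * X 0 ^ 2 + C v * X 0 + C w ≠ m ^ 2 := by
  intro h
  have hdeg : m.totalDegree ≤ 1 := by
    have h1 : (C p * X 1 ^ 2 + C q * X 0 ^ 2 + C v * X 0 + C w : MvPolynomial (Fin 2) ℂ).totalDegree ≤ 2 := by
      refine (totalDegree_add _ _).trans (max_le ((totalDegree_add _ _).trans
        (max_le ((totalDegree_add _ _).trans (max_le ?_ ?_)) ?_)) (by simp))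
      · exact (totalDegree_mul _ _).trans (by simp)
      · exact (totalDegree_mul _ _).trans (by simp)
      · exact (totalDegree_mul _ _).trans (by simp)
    rw [h] at h1
    by_cases hm : m = 0
    · simp [hm]
    · rw [pow_two, totalDegree_mul_of_isDomain hm hm] at h1
      omega
  obtain ⟨a, b, d, e, f, k, rfl, hf⟩ := low_form 1 m hdeg (by norm_num)
  have hf0 := hf le_rfl
  subst hf0
  have E (i j : ℂ) := congrArg (eval ![i, j]) h
  simp only [map_add, map_mul, map_pow, eval_C, eval_X, Matrix.cons_val_zero, Matrix.cons_val_one] at E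
  have he : e = 0 := pow_eq_zero_iff two_ne_zero |>.1 (by
    linear_combination -(1/24) * (E 0 0 - 4 * E 1 0 + 6 * E 2 0 - 4 * E 3 0 + E 4 0))
  have hk : k = 0 := pow_eq_zero_iff two_ne_zero |>.1 (by
    linear_combination -(1/24) * (E 0 0 - 4 * E 0 1 + 6 * E 0 2 - 4 * E 0 3 + E 0 4))
  subst he hk
  have e1 : b * d = 0 := by linear_combination -(1/2) * (E 1 1 - E 1 0 - E 0 1 + E 0 0)
  have e2 : b ^ 2 = q := by linear_combination -(1/2) * (E 2 0 - 2 * E 1 0 + E 0 0)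
  have e3 : d ^ 2 = p := by linear_combination -(1/2) * (E 0 2 - 2 * E 0 1 + E 0 0)
  rcases mul_eq_zero.1 e1 with h0 | h0
  · apply hq; rw [← e2, h0]; ring
  · apply hp; rw [← e3, h0]; ring

/-- `g` is irreducible and of non-torus type. -/
theorem g_irreducible_and_non_torus :
    Irreducible g ∧
      ¬ ∃ p q : MvPolynomial (Fin 2) ℂ,
        p.totalDegree ≤ 2 ∧ q.totalDegree ≤ 3 ∧ g = p ^ 3 + q ^ 2 := by
  obtain ⟨r, hr⟩ : ∃ r, r = Real.sqrt 854 := ⟨_, rfl⟩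
  obtain ⟨u, hu⟩ : ∃ u, u = Real.sqrt 17 := ⟨_, rfl⟩
  have hr2 : r ^ 2 = 854 := by rw [hr]; exact Real.sq_sqrt (by norm_num)
  have hu2 : u ^ 2 = 17 := by rw [hu]; exact Real.sq_sqrt (by norm_num)
  obtain ⟨k1, k2, k3, k4, k5, k6, k7, k8⟩ := real_facts r u hr2 hu2 (hr ▸ Real.sqrt_nonneg _)
    (hu ▸ Real.sqrt_nonneg _)
  have hs : s = C (r : ℂ) := by rw [s, hr]
  have hh2 : h2 = C ((-2179/4332+4/1083*r : ℝ) : ℂ) * X 1 ^ 2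
      + C ((-(53/1083)*r-131/1444 : ℝ) : ℂ) * X 0 ^ 2
      + C (((1350/361 - 49/1083*r) + (29/361*r - 1655/722) : ℝ) : ℂ) * X 0
      + C ((- 2036/1083 + 10/361 * r - 34/1083*r+1997/1444 : ℝ) : ℂ) := by
    rw [h2, hs]
    simp only [c, x, y]
    push_cast
    simp only [map_add, map_mul, map_sub, map_neg, neg_div]
    ring
  have hu2' : (u : ℂ) ^ 2 = 17 := by exact_mod_cast hu2
  have key := transfer ((-7/152 + r/342 : ℝ) : ℂ) ((2 * ((163 - r)/171) : ℝ) : ℂ)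
    (((163 - r)/171 : ℝ) : ℂ) ((31/152 + r/342 : ℝ) : ℂ)
    (((7 - u)/16 : ℝ) : ℂ) (((7 + u)/16 : ℝ) : ℂ) ?_ ?_ ?_ ?_ ?_ f2 g2 h2 ?_ ?_ ?_ ?_ ?_ ?_
  · exact key
  · have : (7 + u)/16 - (7 - u)/16 ≠ 0 := by linarith
    exact_mod_cast this
  · exact_mod_cast k1.ne'
  · exact_mod_cast k2.ne'
  · exact_mod_cast k3.ne'
  · exact_mod_cast k4.ne'
  · rw [f2, hs]
    simp only [c, x, y]
    have e1 : (163/171 : ℂ) = 163 * (1/171) := by norm_num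
    apply MvPolynomial.funext
    intro z
    simp
    ring
  · rw [g2]
    simp only [c, x, y]
    apply MvPolynomial.funext
    intro z
    simp
    linear_combination (z 0 - 1) ^ 2 / 256 * hu2'
  · rw [hh2]
    refine (totalDegree_add _ _).trans (max_le ((totalDegree_add _ _).trans
      (max_le ((totalDegree_add _ _).trans (max_le ?_ ?_)) ?_)) (by simp only [totalDegree_C]; omega))
    · exact (totalDegree_mul _ _).trans (by rw [totalDegree_C]; simp)
    · exact (totalDegree_mul _ _).trans (by rw [totalDegree_C]; simp)
    · exact (totalDegree_mul _ _).trans (by rw [totalDegree_C]; simp)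
  · intro m
    rw [hh2]
    apply nonsq
    · have : -2179/4332+4/1083*r ≠ 0 := by linarith
      exact_mod_cast this
    · have : -(53/1083)*r-131/1444 ≠ 0 := by linarith
      exact_mod_cast this
  · have : (1545 - 60 * r)/4332 ≠ 0 := by linarith
    have h' : (((1545 - 60 * r)/4332 : ℝ) : ℂ) ≠ 0 := by exact_mod_cast this
    rw [hh2]
    convert h' using 1
    simp only [map_add, map_mul, map_pow, eval_C, eval_X, Matrix.cons_val_zero, Matrix.cons_val_one]
    push_cast
    ring
  · rw [hh2]
    simp only [map_add, map_mul, map_pow, eval_C, eval_X, Matrix.cons_val_zero, Matrix.cons_val_one]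
    intro h0
    have h1 : (-2179/4332+4/1083*r) * (1 - ((7 - u)/16) * ((-7/152 + r/342) + 2 * ((163 - r)/171) * ((7 - u)/16))
          / ((163 - r)/171 * ((7 - u)/16)^2 + (31/152 + r/342))) ^ 2
      + (-(53/1083)*r-131/1444) * (1 - ((-7/152 + r/342) + 2 * ((163 - r)/171) * ((7 - u)/16))
          / ((163 - r)/171 * ((7 - u)/16)^2 + (31/152 + r/342))) ^ 2
      + ((1350/361 - 49/1083*r) + (29/361*r - 1655/722))
        * (1 - ((-7/152 + r/342) + 2 * ((163 - r)/171) * ((7 - u)/16))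
          / ((163 - r)/171 * ((7 - u)/16)^2 + (31/152 + r/342)))
      + (- 2036/1083 + 10/361 * r - 34/1083*r+1997/1444) = 0 := by exact_mod_cast h0
    generalize (-7/152 + r/342) + 2 * ((163 - r)/171) * ((7 - u)/16) = P at *
    generalize (163 - r)/171 * ((7 - u)/16)^2 + (31/152 + r/342) = Q at *
    generalize (7 - u)/16 = t at *
    obtain ⟨z, hz⟩ : ∃ z, z = P / Q := ⟨_, rfl⟩
    have hPz : P = z * Q := by rw [hz]; field_simp
    rw [mul_div_assoc, ← hz] at h1
    rw [hPz] at k8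
    apply k8.ne
    linear_combination Q ^ 2 * h1

end
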